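/- arXiv:0911.0105 — 6 statements merged into one kernel-verified Lean document; each statement's English description precedes it below -/
import Mathlib

section
/- For every prime p and every natural number k ≥ 1, the set {p^{nk} : n ∈ ℕ} of k-th powers of p is definable by an arithmetic circuit, i.e. it is {⊕,⊗}-definable. -/
noncomputable section
open Classical

/-- `s ⊕ t`: lifted addition on sets of naturals. -/
def setPlus (s t : Set ℕ) : Set ℕ := {u | ∃ m ∈ s, ∃ n ∈ t, u = m + n}

/-- `s ⊗ t`: lifted multiplication on sets of naturals. -/
def setTimes (s t : Set ℕ) : Set ℕ := {u | ∃ m ∈ s, ∃ n ∈ t, u = m * n}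

/-- Sets of naturals definable by (variable-free) arithmetic circuits:
the smallest collection containing `∅`, `ℕ`, all singletons, closed under
union, intersection, complement, `⊕` and `⊗`. -/
inductive ArithDefinable : Set ℕ → Prop
  | empty : ArithDefinable ∅
  | univ : ArithDefinable Set.univ
  | single (k : ℕ) : ArithDefinable {k}
  | union : ∀ {s t : Set ℕ}, ArithDefinable s → ArithDefinable t → ArithDefinable (s ∪ t)
  | inter : ∀ {s t : Set ℕ}, ArithDefinable s → ArithDefinable t → ArithDefinable (s ∩ t)
  | compl : ∀ {s : Set ℕ}, ArithDefinable s → ArithDefinable sᶜ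
  | plus : ∀ {s t : Set ℕ}, ArithDefinable s → ArithDefinable t → ArithDefinable (setPlus s t)
  | times : ∀ {s t : Set ℕ}, ArithDefinable s → ArithDefinable t → ArithDefinable (setTimes s t)

/-- A set-function of arity `k`. -/
abbrev SetFun (k : ℕ) := (Fin k → Set ℕ) → Set ℕ

/-- The `𝒪`-definable functions `ℙ^n → ℙ`, for a collection `O` of set-functions
(given per arity): smallest class containing projections and the constants
`∅`, `ℕ`, `{k}`, closed under pointwise union, intersection, complement, and
composition with functions in `O`. -/
inductive ODef (O : ∀ k, Set (SetFun k)) (n : ℕ) : SetFun n → Prop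
  | proj (i : Fin n) : ODef O n (fun s => s i)
  | empty : ODef O n (fun _ => ∅)
  | univ : ODef O n (fun _ => Set.univ)
  | single (k : ℕ) : ODef O n (fun _ => {k})
  | union : ∀ {F G : SetFun n}, ODef O n F → ODef O n G → ODef O n (fun s => F s ∪ G s)
  | inter : ∀ {F G : SetFun n}, ODef O n F → ODef O n G → ODef O n (fun s => F s ∩ G s)
  | compl : ∀ {F : SetFun n}, ODef O n F → ODef O n (fun s => (F s)ᶜ)
  | comp : ∀ {k : ℕ} {g : SetFun k} {F : Fin k → SetFun n},
      g ∈ O k → (∀ i, ODef O n (F i)) → ODef O n (fun s => g (fun i => F i s))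

/-- `s_{|m} = s ∩ {0,…,m}`. -/
def restrict (s : Set ℕ) (m : ℕ) : Set ℕ := s ∩ {k | k ≤ m}

/-- `F` is `h`-continuous on `D`. -/
def HCont (h : ℕ → ℕ) {n : ℕ} (F : SetFun n) (D : Set (Fin n → Set ℕ)) : Prop :=
  ∀ m : ℕ, ∀ s ∈ D, ∀ t ∈ D,
    (∀ i, restrict (s i) (h m) = restrict (t i) (h m)) →
    restrict (F s) m = restrict (F t) m

/-- `F` is uniformly continuous on `D`. -/
def UnifCont {n : ℕ} (F : SetFun n) (D : Set (Fin n → Set ℕ)) : Prop :=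
  ∃ h : ℕ → ℕ, HCont h F D

/-- `𝒰`: set-functions (of arity `k`) uniformly continuous on the whole space. -/
def Ucal (k : ℕ) : Set (SetFun k) := {g | UnifCont g Set.univ}

/-- `𝒫`: predicates, i.e. set-functions with values among `∅` and `{0}`. -/
def Pcal (k : ℕ) : Set (SetFun k) := {g | ∀ s, g s = ∅ ∨ g s = {0}}

/-- `𝒰 ∪ 𝒫`. -/
def UPcal (k : ℕ) : Set (SetFun k) := Ucal k ∪ Pcal k

/-- `Max(x)`. -/
def MaxFun (x : Set ℕ) : Set ℕ :=
  if x = ∅ then ∅ else if x.Infinite then Set.univ else {sSup x}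

/-- `Card(x)`. -/
def CardFun (x : Set ℕ) : Set ℕ := if x.Finite then {x.ncard} else Set.univ

/-- `↓(x)`. -/
def DownFun (x : Set ℕ) : Set ℕ := {m | ∃ n ∈ x, m ≤ n}

/-- `Sum(x)`. -/
def SumFun (x : Set ℕ) : Set ℕ := if x.Finite then {∑ᶠ n ∈ x, n} else Set.univ

/-- `Prod(x)`. -/
def ProdFun (x : Set ℕ) : Set ℕ := if x.Finite then {∏ᶠ n ∈ x, n} else Set.univ

/-- `Shove(x) = {n - min x : n ∈ x}` (empty for `x = ∅`). -/
def ShoveFun (x : Set ℕ) : Set ℕ := (fun n => n - sInf x) '' x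

/-- `ε(x)`: the test for emptiness. -/
def epsFun (x : Set ℕ) : Set ℕ := if x = ∅ then {0} else ∅

/-- `Fin(x)`: the test for finiteness. -/
def FinFun (x : Set ℕ) : Set ℕ := if x.Finite then {0} else ∅

/-- `⊕` as a set-function of arity 2. -/
def plusFun : SetFun 2 := fun s => setPlus (s 0) (s 1)

/-- `⊗` as a set-function of arity 2. -/
def timesFun : SetFun 2 := fun s => setTimes (s 0) (s 1)

/-- `↓` as a set-function of arity 1. -/
def downFun1 : SetFun 1 := fun s => DownFun (s 0)

/-- `ε` as a set-function of arity 1. -/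
def epsFun1 : SetFun 1 := fun s => epsFun (s 0)

/-- The collection `{⊕, ⊗}`. -/
def arithO : ∀ k, Set (SetFun k)
  | 2 => {plusFun, timesFun}
  | _ => ∅

/-- The collection `{⊕}`. -/
def addO : ∀ k, Set (SetFun k)
  | 2 => {plusFun}
  | _ => ∅

/-- The collection `{⊕, ↓} ∪ 𝒫`. -/
def addDownO : ∀ k, Set (SetFun k)
  | 1 => insert downFun1 (Pcal 1)
  | 2 => insert plusFun (Pcal 2)
  | k => Pcal k

/-- The collection `{⊕, ⊗, ↓} ∪ 𝒫`. -/
def arithDownO : ∀ k, Set (SetFun k)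
  | 1 => insert downFun1 (Pcal 1)
  | 2 => {plusFun, timesFun} ∪ Pcal 2
  | k => Pcal k

/-- The collection `𝒰 ∪ {ε}`. -/
def UEps : ∀ k, Set (SetFun k)
  | 1 => insert epsFun1 (Ucal 1)
  | k => Ucal k

/-- The collection `{⊕, ⊗} ∪ 𝒫`. -/
def arithPO (k : ℕ) : Set (SetFun k) := arithO k ∪ Pcal k

/-- A numerical function `ℕ → ℕ` is `O`-definable if some `O`-definable
set-function maps `{m}` to `{f m}` for every `m`. -/
def NumDef1 (O : ∀ k, Set (SetFun k)) (f : ℕ → ℕ) : Prop :=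
  ∃ F : SetFun 1, ODef O 1 F ∧ ∀ m : ℕ, F (fun _ => {m}) = {f m}

/-- A numerical function `ℕ^k → ℕ` is `O`-definable if some `O`-definable
set-function maps tuples of singletons to the corresponding singleton value. -/
def NumDef (O : ∀ k, Set (SetFun k)) (k : ℕ) (f : (Fin k → ℕ) → ℕ) : Prop :=
  ∃ F : SetFun k, ODef O k F ∧ ∀ m : Fin k → ℕ, F (fun i => ({m i} : Set ℕ)) = {f m}

/-- `f` is regressive: `{f n : f n < n}` is infinite. -/
def Regressive (f : ℕ → ℕ) : Prop := {y | ∃ n, f n = y ∧ y < n}.Infinite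

/-- `f` is semi-regressive: for every `ℓ` there is `n` with `n + ℓ ≤ f n ≤ 2n - 2`. -/
def SemiRegressive (f : ℕ → ℕ) : Prop :=
  ∀ ℓ : ℕ, ∃ n : ℕ, n + ℓ ≤ f n ∧ (f n : ℤ) ≤ 2 * (n : ℤ) - 2

/-- The powers of a prime `p` are the numbers with no divisor other than `1` that is prime to `p`. -/
theorem primePowers_eq_compl_setTimes {p : ℕ} (hp : p.Prime) :
    {x : ℕ | ∃ n : ℕ, x = p ^ n} =
      (setTimes ((setTimes {p} Set.univ)ᶜ ∩ {1}ᶜ) Set.univ)ᶜ := by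
  have mem_multiples : ∀ m, m ∈ setTimes {p} Set.univ ↔ p ∣ m := fun m => by
    simp [setTimes, Dvd.dvd]
  ext x
  constructor
  · rintro ⟨n, rfl⟩ ⟨m, ⟨hm, hm1⟩, l, -, h⟩
    obtain ⟨i, -, rfl⟩ := (Nat.dvd_prime_pow hp).1 (Dvd.intro l h.symm)
    rcases Nat.eq_zero_or_pos i with rfl | hi
    · exact hm1 (pow_zero p)
    · exact hm ((mem_multiples _).2 (dvd_pow_self p hi.ne'))
  · intro hx
    have key : ∀ m, m ∣ x → ¬ p ∣ m → m = 1 := by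
      rintro m ⟨l, hl⟩ hm
      by_contra hm1
      exact hx ⟨m, ⟨fun h => hm ((mem_multiples m).1 h), hm1⟩, l, Set.mem_univ l, hl⟩
    have hx0 : x ≠ 0 := by
      rintro rfl
      have h := key (p + 1) (dvd_zero _) fun h =>
        hp.one_lt.ne' (Nat.dvd_one.1 ((Nat.dvd_add_right dvd_rfl).1 h))
      exact hp.ne_zero (by omega)
    obtain ⟨n, m, hm, hxm⟩ := Nat.exists_eq_pow_mul_and_not_dvd hx0 p hp.ne_one
    have h1 := key m ⟨p ^ n, by rw [hxm, mul_comm]⟩ hm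
    exact ⟨n, by rw [hxm, h1, mul_one]⟩

theorem primePowers_arithDefinable {p : ℕ} (hp : p.Prime) :
    ArithDefinable {x : ℕ | ∃ n : ℕ, x = p ^ n} := by
  rw [primePowers_eq_compl_setTimes hp]
  exact (((ArithDefinable.single p).times .univ).compl.inter
    (ArithDefinable.single 1).compl |>.times .univ).compl

theorem pow_sub_one_dvd_pow_sub_one_iff {p k n : ℕ} (hp : 1 < p) :
    p ^ k - 1 ∣ p ^ n - 1 ↔ k ∣ n := by
  have h1 := Nat.one_le_pow (k.gcd n) p (by omega)
  have h2 := Nat.one_le_pow k p (by omega)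
  rw [← Nat.gcd_eq_left_iff_dvd, ← Nat.gcd_eq_left_iff_dvd,
    Nat.pow_sub_one_gcd_pow_sub_one, ← (Nat.pow_right_injective hp).eq_iff (b := k)]
  omega

/-- The powers of `p` whose exponent is divisible by `k` are those congruent to `1` modulo
`p ^ k - 1`. -/
theorem kthPowers_eq_inter {p : ℕ} (k : ℕ) (hp : 1 < p) :
    {x : ℕ | ∃ n : ℕ, x = p ^ (n * k)} =
      {x : ℕ | ∃ n : ℕ, x = p ^ n} ∩ setPlus {1} (setTimes {p ^ k - 1} Set.univ) := by
  ext x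
  constructor
  · rintro ⟨n, rfl⟩
    obtain ⟨c, hc⟩ := (pow_sub_one_dvd_pow_sub_one_iff hp).2 (dvd_mul_left k n)
    have h1 := Nat.one_le_pow (n * k) p (by omega)
    exact ⟨⟨_, rfl⟩, 1, rfl, _, ⟨_, rfl, c, Set.mem_univ c, rfl⟩, by omega⟩
  · rintro ⟨⟨n, rfl⟩, _, rfl, _, ⟨_, rfl, c, -, rfl⟩, h⟩
    obtain ⟨m, rfl⟩ := (pow_sub_one_dvd_pow_sub_one_iff hp).1 ⟨c, Nat.sub_eq_of_eq_add' h⟩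
    exact ⟨m, by rw [mul_comm]⟩

theorem kth_powers_of_prime_arith_definable (p k : ℕ) (hp : p.Prime) (hk : 1 ≤ k) :
    ArithDefinable {x : ℕ | ∃ n : ℕ, x = p ^ (n * k)} := by
  rw [kthPowers_eq_inter k hp.one_lt]
  exact (primePowers_arithDefinable hp).inter
    ((ArithDefinable.single 1).plus ((ArithDefinable.single (p ^ k - 1)).times .univ))

end
end

section
/- The set of Fermat numbers {2^{2^n} + 1 : n ∈ ℕ} is definable by an arithmetic circuit, i.e. it is {⊕,⊗}-definable. -/
noncomputable section
open Classical

/-- The powers of two are the numbers that are not a multiple of an odd number `≥ 3`. -/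
theorem powers_of_two_eq_compl :
    {x : ℕ | ∃ k : ℕ, x = 2 ^ k} =
      (setTimes Set.univ (setPlus {3} (setTimes {2} Set.univ)))ᶜ := by
  ext x
  constructor
  · rintro ⟨k, rfl⟩ ⟨m, -, _, ⟨_, rfl, _, ⟨_, rfl, n, -, rfl⟩, rfl⟩, h⟩
    obtain ⟨i, -, hi⟩ := (Nat.dvd_prime_pow Nat.prime_two).1 (Dvd.intro_left m h.symm)
    rcases i with _ | i
    · rw [pow_zero] at hi
      omega
    · rw [pow_succ] at hi
      omega
  · intro h
    have hx : x ≠ 0 := by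
      rintro rfl
      exact h ⟨0, trivial, 3, ⟨3, rfl, 0, ⟨2, rfl, 0, trivial, rfl⟩, rfl⟩, rfl⟩
    obtain ⟨k, m, ⟨j, rfl⟩, rfl⟩ := Nat.exists_eq_two_pow_mul_odd hx
    rcases j with _ | j
    · exact ⟨k, by simp⟩
    · refine absurd ⟨2 ^ k, trivial, 2 * (j + 1) + 1, ⟨3, rfl, 2 * j, ⟨2, rfl, j, trivial, rfl⟩, ?_⟩,
        rfl⟩ h
      ring

theorem arithDefinable_powers_of_two : ArithDefinable {x : ℕ | ∃ k : ℕ, x = 2 ^ k} := by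
  rw [powers_of_two_eq_compl]
  exact .compl (.times .univ (.plus (.single 3) (.times (.single 2) .univ)))

/-- A Fermat number has no proper divisor of the form `2 ^ a + 1` with `a ≠ 0`. -/
theorem eq_two_pow_of_two_pow_add_one_dvd_fermatNumber {a n : ℕ} (ha : a ≠ 0)
    (h : 2 ^ a + 1 ∣ Nat.fermatNumber n) : a = 2 ^ n := by
  obtain ⟨k, m, hm, rfl⟩ := Nat.exists_eq_two_pow_mul_odd ha
  have hk : Nat.fermatNumber k ∣ 2 ^ (2 ^ k * m) + 1 := by
    simpa [Nat.fermatNumber, pow_mul] using hm.nat_add_dvd_pow_add_pow (2 ^ 2 ^ k) 1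
  obtain rfl : k = n := by
    by_contra hkn
    exact Nat.fermatNumber_ne_one k
      ((Nat.coprime_fermatNumber_fermatNumber hkn).eq_one_of_dvd (hk.trans h))
  have hle : 2 ^ (2 ^ k * m) ≤ 2 ^ 2 ^ k :=
    Nat.le_of_add_le_add_right (Nat.le_of_dvd (Nat.succ_pos _) h)
  exact le_antisymm ((Nat.pow_le_pow_iff_right one_lt_two).1 hle)
    (Nat.le_mul_of_pos_right _ hm.pos)

/-- The Fermat numbers are the numbers `2 ^ k + 1` with `k ≠ 0` that are not a proper multiple
of another such number. -/
theorem fermat_numbers_eq :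
    {x : ℕ | ∃ n : ℕ, x = 2 ^ (2 ^ n) + 1} =
      setPlus ({x | ∃ k : ℕ, x = 2 ^ k} ∩ {1}ᶜ) {1} ∩
        (setTimes (setPlus ({x | ∃ k : ℕ, x = 2 ^ k} ∩ {1}ᶜ) {1}) (setPlus Set.univ {2}))ᶜ := by
  ext x
  constructor
  · rintro ⟨n, rfl⟩
    refine ⟨⟨2 ^ 2 ^ n, ⟨⟨2 ^ n, rfl⟩, by simp⟩, 1, rfl, rfl⟩, ?_⟩
    rintro ⟨_, ⟨_, ⟨⟨a, rfl⟩, ha⟩, _, rfl, rfl⟩, _, ⟨c, -, _, rfl, rfl⟩, h⟩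
    have ha0 : a ≠ 0 := by
      rintro rfl
      exact ha rfl
    rw [eq_two_pow_of_two_pow_add_one_dvd_fermatNumber ha0 (Dvd.intro _ h.symm)] at h
    nlinarith [Nat.zero_le ((2 ^ 2 ^ n + 1) * c), Nat.zero_le (2 ^ 2 ^ n)]
  · rintro ⟨⟨_, ⟨⟨a, rfl⟩, ha⟩, _, rfl, rfl⟩, hx⟩
    have ha0 : a ≠ 0 := by
      rintro rfl
      exact ha rfl
    obtain ⟨k, m, hm, rfl⟩ := Nat.exists_eq_two_pow_mul_odd ha0
    obtain ⟨c, hc⟩ : 2 ^ 2 ^ k + 1 ∣ 2 ^ (2 ^ k * m) + 1 := by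
      simpa [pow_mul] using hm.nat_add_dvd_pow_add_pow (2 ^ 2 ^ k) 1
    rcases c with _ | _ | c
    · simp at hc
    · exact ⟨k, by simpa using hc⟩
    · exact absurd ⟨_, ⟨_, ⟨⟨2 ^ k, rfl⟩, by simp⟩, 1, rfl, rfl⟩, _, ⟨c, trivial, 2, rfl, rfl⟩, hc⟩ hx

theorem fermat_numbers_arith_definable :
    ArithDefinable {x : ℕ | ∃ n : ℕ, x = 2 ^ (2 ^ n) + 1} := by
  have h : ArithDefinable (setPlus ({x | ∃ k : ℕ, x = 2 ^ k} ∩ {1}ᶜ) {1}) :=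
    .plus (.inter arithDefinable_powers_of_two (.compl (.single 1))) (.single 1)
  rw [fermat_numbers_eq]
  exact .inter h (.compl (.times h (.plus .univ (.single 2))))

end
end

section
/- Every set s ⊆ ℕ definable by an arithmetic circuit is computable; that is, membership in s is a decidable (computable) predicate. -/
noncomputable section
open Classical

/-- Bounded search: if the Boolean test `f n m` is computable, then so is the existence of some
`m ≤ n` passing it. -/
theorem computablePred_exists_le {f : ℕ → ℕ → Bool} (hf : Computable₂ f) :
    ComputablePred fun n => ∃ m ≤ n, f n m = true := by
  have hstep : Computable₂ fun (n : ℕ) (p : ℕ × Bool) => p.2 || f n p.1 :=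
    Primrec.or.to_comp.comp (Computable.snd.comp Computable.snd)
      (hf.comp Computable.fst (Computable.fst.comp Computable.snd))
  have hrec : Computable fun n => Nat.rec (motive := fun _ => Bool) false
      (fun m b => b || f n m) (n + 1) :=
    Computable.nat_rec Computable.succ (Computable.const false) hstep
  refine ComputablePred.computable_iff.2 ⟨_, hrec, funext fun n => propext ?_⟩
  have key : ∀ k, Nat.rec (motive := fun _ => Bool) false (fun m b => b || f n m) k = true ↔
      ∃ m < k, f n m = true := by
    intro k
    induction k with
    | zero => simp
    | succ k ih =>
      simp only [Bool.or_eq_true, ih, Nat.lt_succ_iff_lt_or_eq]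
      grind
  simpa only [Nat.lt_succ_iff] using (key (n + 1)).symm

theorem mem_setPlus_iff {s t : Set ℕ} {n : ℕ} :
    n ∈ setPlus s t ↔ ∃ m ≤ n, m ∈ s ∧ n - m ∈ t := by
  constructor
  · rintro ⟨a, ha, b, hb, rfl⟩
    exact ⟨a, Nat.le_add_right a b, ha, by simpa using hb⟩
  · rintro ⟨m, hm, hs, ht⟩
    exact ⟨m, hs, n - m, ht, by omega⟩

theorem mem_setTimes_iff {s t : Set ℕ} {n : ℕ} (hn : n ≠ 0) :
    n ∈ setTimes s t ↔ ∃ m ≤ n, m ∈ s ∧ n / m ∈ t ∧ m * (n / m) = n := by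
  constructor
  · rintro ⟨a, ha, b, hb, rfl⟩
    have ha0 : 0 < a := Nat.pos_of_ne_zero (left_ne_zero_of_mul hn)
    have hb0 : 0 < b := Nat.pos_of_ne_zero (right_ne_zero_of_mul hn)
    have hdiv : a * b / a = b := Nat.mul_div_cancel_left b ha0
    exact ⟨a, Nat.le_mul_of_pos_right a hb0, ha, by rwa [hdiv], by rw [hdiv]⟩
  · rintro ⟨m, -, hs, ht, h⟩
    exact ⟨m, hs, n / m, ht, h.symm⟩

/-- Changing a computable predicate at `0` keeps it computable. -/
theorem ComputablePred.of_eq_of_ne_zero {p q : ℕ → Prop} (hp : ComputablePred p)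
    (h : ∀ n ≠ 0, (p n ↔ q n)) : ComputablePred q := by
  obtain ⟨f, hf, rfl⟩ := ComputablePred.computable_iff.1 hp
  have hsucc : Computable₂ fun _ k : ℕ => f (k + 1) :=
    (hf.comp (Computable.succ.comp Computable.snd)).to₂
  have hcases : Computable fun n => Nat.casesOn (motive := fun _ => Bool) n
      (decide (q 0)) fun k => f (k + 1) :=
    Computable.nat_casesOn Computable.id (Computable.const _) hsucc
  refine ComputablePred.computable_iff.2 ⟨_, hcases, funext fun n => propext ?_⟩
  cases n with
  | zero => simp
  | succ k => exact (h (k + 1) k.succ_ne_zero).symm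

theorem computablePred_mem_setPlus {s t : Set ℕ} (hs : ComputablePred (· ∈ s))
    (ht : ComputablePred (· ∈ t)) : ComputablePred (· ∈ setPlus s t) := by
  have hf : Computable₂ fun n m : ℕ => decide (m ∈ s) && decide (n - m ∈ t) :=
    Primrec.and.to_comp.comp (hs.decide.comp Computable.snd)
      (ht.decide.comp Primrec.nat_sub.to_comp)
  exact (computablePred_exists_le hf).of_eq fun n => by simp [mem_setPlus_iff]

theorem computablePred_mem_setTimes {s t : Set ℕ} (hs : ComputablePred (· ∈ s))
    (ht : ComputablePred (· ∈ t)) : ComputablePred (· ∈ setTimes s t) := by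
  have hdiv : Computable₂ fun n m : ℕ => n / m := Primrec.nat_div.to_comp
  have heq : Computable₂ fun n m : ℕ => decide (m * (n / m) = n) :=
    (Primrec.eq (α := ℕ)).decide.to_comp.comp
      (Primrec.nat_mul.to_comp.comp Computable.snd hdiv) Computable.fst
  have hf : Computable₂ fun n m : ℕ =>
      decide (m ∈ s) && (decide (n / m ∈ t) && decide (m * (n / m) = n)) :=
    Primrec.and.to_comp.comp (hs.decide.comp Computable.snd)
      (Primrec.and.to_comp.comp (ht.decide.comp hdiv) heq)
  exact (computablePred_exists_le hf).of_eq_of_ne_zero fun n hn => by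
    simp [mem_setTimes_iff hn]

theorem arithDefinable_computablePred (s : Set ℕ) (h : ArithDefinable s) :
    ComputablePred (· ∈ s) := by
  induction h with
  | empty => exact ComputablePred.computable_iff.2 ⟨fun _ => false, Computable.const _, by simp⟩
  | univ => exact ComputablePred.computable_iff.2 ⟨fun _ => true, Computable.const _, by simp⟩
  | single k =>
    exact (PrimrecRel.comp Primrec.eq Primrec.id (Primrec.const k)).computablePred
  | union _ _ hs ht =>
    exact ComputablePred.computable_iff.2
      ⟨_, Primrec.or.to_comp.comp hs.decide ht.decide, by ext; simp⟩
  | inter _ _ hs ht =>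
    exact ComputablePred.computable_iff.2
      ⟨_, Primrec.and.to_comp.comp hs.decide ht.decide, by ext; simp⟩
  | compl _ hs => exact hs.not
  | plus _ _ hs ht => exact computablePred_mem_setPlus hs ht
  | times _ _ hs ht => exact computablePred_mem_setTimes hs ht

end
end

section
/- Let h : ℕ → ℕ be inflationary (h(m) ≥ m for all m) and let 𝒪 be a collection of set-functions each of which is h-continuous on the whole space. Then every 𝒪-definable function F : ℙ^n → ℙ is h^{(k)}-continuous on ℙ^n for some k ∈ ℕ, where h^{(k)} denotes the k-fold iterate of h (h^{(0)} = id). -/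
noncomputable section
open Classical

theorem restrict_eq_restrict_iff {s t : Set ℕ} {m : ℕ} :
    restrict s m = restrict t m ↔ ∀ k ≤ m, (k ∈ s ↔ k ∈ t) := by
  simp only [restrict, Set.ext_iff, Set.mem_inter_iff, Set.mem_ofPred_eq]
  exact forall_congr' fun k => and_congr_left_iff

theorem HCont.mono {h h' : ℕ → ℕ} {n : ℕ} {F : SetFun n} {D : Set (Fin n → Set ℕ)}
    (hF : HCont h F D) (hle : ∀ m, h m ≤ h' m) : HCont h' F D := by
  intro m s hs t ht hst
  refine hF m s hs t ht fun i => ?_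
  rw [restrict_eq_restrict_iff]
  exact fun k hk => restrict_eq_restrict_iff.1 (hst i) k (hk.trans (hle m))

theorem HCont.iterate_mono {h : ℕ → ℕ} (hh : ∀ m, m ≤ h m) {a b : ℕ} (hab : a ≤ b) {n : ℕ}
    {F : SetFun n} {D : Set (Fin n → Set ℕ)} (hF : HCont (h^[a]) F D) : HCont (h^[b]) F D :=
  hF.mono (Function.monotone_iterate_of_id_le hh hab)

theorem HCont.const (h : ℕ → ℕ) {n : ℕ} (c : Set ℕ) (D : Set (Fin n → Set ℕ)) :
    HCont h (fun _ => c) D :=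
  fun _ _ _ _ _ _ => rfl

theorem HCont.proj {n : ℕ} (i : Fin n) (D : Set (Fin n → Set ℕ)) :
    HCont id (fun s => s i) D :=
  fun _ _ _ _ _ hst => hst i

theorem HCont.union {h : ℕ → ℕ} {n : ℕ} {F G : SetFun n} {D : Set (Fin n → Set ℕ)}
    (hF : HCont h F D) (hG : HCont h G D) : HCont h (fun s => F s ∪ G s) D := by
  intro m s hs t ht hst
  have hFm := hF m s hs t ht hst
  have hGm := hG m s hs t ht hst
  rw [restrict_eq_restrict_iff] at hFm hGm ⊢
  exact fun k hk => or_congr (hFm k hk) (hGm k hk)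

theorem HCont.inter {h : ℕ → ℕ} {n : ℕ} {F G : SetFun n} {D : Set (Fin n → Set ℕ)}
    (hF : HCont h F D) (hG : HCont h G D) : HCont h (fun s => F s ∩ G s) D := by
  intro m s hs t ht hst
  have hFm := hF m s hs t ht hst
  have hGm := hG m s hs t ht hst
  rw [restrict_eq_restrict_iff] at hFm hGm ⊢
  exact fun k hk => and_congr (hFm k hk) (hGm k hk)

theorem HCont.compl {h : ℕ → ℕ} {n : ℕ} {F : SetFun n} {D : Set (Fin n → Set ℕ)}
    (hF : HCont h F D) : HCont h (fun s => (F s)ᶜ) D := by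
  intro m s hs t ht hst
  have hFm := hF m s hs t ht hst
  rw [restrict_eq_restrict_iff] at hFm ⊢
  exact fun k hk => not_congr (hFm k hk)

theorem HCont.comp {h h' : ℕ → ℕ} {n k : ℕ} {g : SetFun k} {F : Fin k → SetFun n}
    {D : Set (Fin n → Set ℕ)} (hg : HCont h g Set.univ) (hF : ∀ i, HCont h' (F i) D) :
    HCont (h' ∘ h) (fun s => g (fun i => F i s)) D :=
  fun m s hs t ht hst =>
    hg m _ (Set.mem_univ _) _ (Set.mem_univ _) fun i => hF i (h m) s hs t ht hst

theorem odef_iterate_continuous (h : ℕ → ℕ) (hh : ∀ m, m ≤ h m)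
    (O : ∀ k, Set (SetFun k)) (hO : ∀ k, ∀ g ∈ O k, HCont h g Set.univ)
    (n : ℕ) (F : SetFun n) (hF : ODef O n F) :
    ∃ k : ℕ, HCont (h^[k]) F Set.univ := by
  induction hF with
  | proj i => exact ⟨0, HCont.proj i _⟩
  | empty => exact ⟨0, HCont.const _ _ _⟩
  | univ => exact ⟨0, HCont.const _ _ _⟩
  | single k => exact ⟨0, HCont.const _ _ _⟩
  | union _ _ ihF ihG =>
    obtain ⟨a, ha⟩ := ihF
    obtain ⟨b, hb⟩ := ihG
    exact ⟨max a b, (ha.iterate_mono hh (le_max_left a b)).union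
      (hb.iterate_mono hh (le_max_right a b))⟩
  | inter _ _ ihF ihG =>
    obtain ⟨a, ha⟩ := ihF
    obtain ⟨b, hb⟩ := ihG
    exact ⟨max a b, (ha.iterate_mono hh (le_max_left a b)).inter
      (hb.iterate_mono hh (le_max_right a b))⟩
  | compl _ ih =>
    obtain ⟨a, ha⟩ := ih
    exact ⟨a, ha.compl⟩
  | comp hg _ ih =>
    choose a ha using ih
    exact ⟨Finset.univ.sup a + 1, (hO _ _ hg).comp fun i =>
      (ha i).iterate_mono hh (Finset.le_sup (Finset.mem_univ i))⟩

end
end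

section
/- None of the three functions ↓, Max, Card : ℙ → ℙ is definable by an arithmetic circuit, i.e. none is {⊕,⊗}-definable. -/
noncomputable section
open Classical

/-- `F` is local up to finitely many cases: on each of finitely many classes of arguments, whether
`m ∈ F s` depends only on the elements of the arguments that are at most `m`. -/
def FinitelyLocal {n : ℕ} (F : SetFun n) : Prop :=
  ∃ (κ : Type) (_ : Finite κ) (c : (Fin n → Set ℕ) → κ), ∀ s t, c s = c t → ∀ m : ℕ,
    (∀ i, ∀ k ≤ m, k ∈ s i ↔ k ∈ t i) → (m ∈ F s ↔ m ∈ F t)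

lemma mem_setPlus_congr {A B A' B' : Set ℕ} {m : ℕ} (hA : ∀ k ≤ m, k ∈ A ↔ k ∈ A')
    (hB : ∀ k ≤ m, k ∈ B ↔ k ∈ B') : m ∈ setPlus A B ↔ m ∈ setPlus A' B' := by
  constructor <;> rintro ⟨a, ha, b, hb, rfl⟩
  · exact ⟨a, (hA a (by omega)).1 ha, b, (hB b (by omega)).1 hb, rfl⟩
  · exact ⟨a, (hA a (by omega)).2 ha, b, (hB b (by omega)).2 hb, rfl⟩

lemma mem_setTimes_of_agree {A B A' B' : Set ℕ} {m : ℕ} (hA : ∀ k ≤ m, k ∈ A → k ∈ A')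
    (hB : ∀ k ≤ m, k ∈ B → k ∈ B') (nA : A.Nonempty → A'.Nonempty)
    (nB : B.Nonempty → B'.Nonempty) (h : m ∈ setTimes A B) : m ∈ setTimes A' B' := by
  obtain ⟨a, ha, b, hb, rfl⟩ := h
  rcases Nat.eq_zero_or_pos a with rfl | ha0
  · obtain ⟨b', hb'⟩ := nB ⟨b, hb⟩
    exact ⟨0, hA 0 (Nat.zero_le _) ha, b', hb', by simp⟩
  rcases Nat.eq_zero_or_pos b with rfl | hb0
  · obtain ⟨a', ha'⟩ := nA ⟨a, ha⟩
    exact ⟨a', ha', 0, hB 0 (Nat.zero_le _) hb, by simp⟩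
  exact ⟨a, hA a (Nat.le_mul_of_pos_right a hb0) ha, b, hB b (Nat.le_mul_of_pos_left b ha0) hb, rfl⟩

lemma mem_setTimes_congr {A B A' B' : Set ℕ} {m : ℕ} (hA : ∀ k ≤ m, k ∈ A ↔ k ∈ A')
    (hB : ∀ k ≤ m, k ∈ B ↔ k ∈ B') (nA : A.Nonempty ↔ A'.Nonempty)
    (nB : B.Nonempty ↔ B'.Nonempty) : m ∈ setTimes A B ↔ m ∈ setTimes A' B' :=
  ⟨mem_setTimes_of_agree (fun k hk => (hA k hk).1) (fun k hk => (hB k hk).1) nA.1 nB.1,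
    mem_setTimes_of_agree (fun k hk => (hA k hk).2) (fun k hk => (hB k hk).2) nA.2 nB.2⟩

namespace FinitelyLocal

variable {n : ℕ} {F G : SetFun n}

lemma const (A : Set ℕ) : FinitelyLocal (fun _ : Fin n → Set ℕ => A) :=
  ⟨Unit, inferInstance, fun _ => (), fun _ _ _ _ _ => Iff.rfl⟩

lemma proj (i : Fin n) : FinitelyLocal (fun s : Fin n → Set ℕ => s i) :=
  ⟨Unit, inferInstance, fun _ => (), fun _ _ _ m h => h i m le_rfl⟩

lemma compl (hF : FinitelyLocal F) : FinitelyLocal (fun s => (F s)ᶜ) := by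
  obtain ⟨κ, hκ, c, hc⟩ := hF
  exact ⟨κ, hκ, c, fun s t hst m h => not_congr (hc s t hst m h)⟩

/-- A binary operation preserves `FinitelyLocal` if membership of `m` in its value is determined by
the elements of its arguments up to `m` and by which of its arguments are nonempty. -/
lemma map₂ {op : Set ℕ → Set ℕ → Set ℕ}
    (hop : ∀ {A B A' B' : Set ℕ} {m : ℕ}, (∀ k ≤ m, k ∈ A ↔ k ∈ A') → (∀ k ≤ m, k ∈ B ↔ k ∈ B') →
      (A.Nonempty ↔ A'.Nonempty) → (B.Nonempty ↔ B'.Nonempty) → (m ∈ op A B ↔ m ∈ op A' B'))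
    (hF : FinitelyLocal F) (hG : FinitelyLocal G) : FinitelyLocal (fun s => op (F s) (G s)) := by
  obtain ⟨κ, hκ, c, hc⟩ := hF
  obtain ⟨μ, hμ, d, hd⟩ := hG
  refine ⟨(κ × μ) × (Prop × Prop), inferInstance,
    fun s => ((c s, d s), ((F s).Nonempty, (G s).Nonempty)), fun s t hst m h => ?_⟩
  simp only [Prod.mk.injEq] at hst
  obtain ⟨⟨hcst, hdst⟩, hFst, hGst⟩ := hst
  exact hop (fun k hk => hc s t hcst k fun i l hl => h i l (hl.trans hk))
    (fun k hk => hd s t hdst k fun i l hl => h i l (hl.trans hk)) (iff_of_eq hFst) (iff_of_eq hGst)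

end FinitelyLocal

lemma ODef.finitelyLocal {n : ℕ} {F : SetFun n} (hF : ODef arithO n F) : FinitelyLocal F := by
  induction hF with
  | proj i => exact .proj i
  | empty => exact .const ∅
  | univ => exact .const Set.univ
  | single k => exact .const {k}
  | union _ _ ihF ihG =>
    exact ihF.map₂ (op := (· ∪ ·)) (fun hA hB _ _ => or_congr (hA _ le_rfl) (hB _ le_rfl)) ihG
  | inter _ _ ihF ihG =>
    exact ihF.map₂ (op := (· ∩ ·)) (fun hA hB _ _ => and_congr (hA _ le_rfl) (hB _ le_rfl)) ihG
  | compl _ ih => exact ih.compl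
  | @comp k g F hg _ ih =>
    match k, g, F, hg, ih with
    | 0, _, _, hg, _ => exact hg.elim
    | 1, _, _, hg, _ => exact hg.elim
    | 2, _, F, hg, ih =>
      rcases hg with rfl | rfl
      · exact (ih 0).map₂ (fun hA hB _ _ => mem_setPlus_congr hA hB) (ih 1)
      · exact (ih 0).map₂ mem_setTimes_congr (ih 1)
    | _ + 3, _, _, hg, _ => exact hg.elim

/-- The set `{0, 2, …, 2 * i}`. -/
def evensUpTo (i : ℕ) : Set ℕ := (fun k => 2 * k) '' Set.Iic i

lemma mem_evensUpTo {i x : ℕ} : x ∈ evensUpTo i ↔ ∃ k ≤ i, 2 * k = x := Iff.rfl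

lemma FinitelyLocal.exists_evensUpTo_agree {f : Set ℕ → Set ℕ}
    (hf : FinitelyLocal (n := 1) (fun s => f (s 0))) :
    ∃ i j, i < j ∧ ∀ m ≤ 2 * i + 1, m ∈ f (evensUpTo i) ↔ m ∈ f (evensUpTo j) := by
  obtain ⟨κ, hκ, c, hc⟩ := hf
  obtain ⟨i, j, hij, hcol⟩ :
      ∃ i j, i < j ∧ c (fun _ => evensUpTo i) = c (fun _ => evensUpTo j) := by
    obtain ⟨i, j, hne, h⟩ :=
      Finite.exists_ne_map_eq_of_infinite fun i : ℕ => c (fun _ => evensUpTo i)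
    rcases hne.lt_or_gt with hlt | hlt
    · exact ⟨i, j, hlt, h⟩
    · exact ⟨j, i, hlt, h.symm⟩
  refine ⟨i, j, hij, fun m hm => hc _ _ hcol m fun _ k hk => ?_⟩
  simp only [mem_evensUpTo]
  constructor <;> rintro ⟨l, hl, rfl⟩ <;> exact ⟨l, by omega, rfl⟩

lemma maxFun_evensUpTo (i : ℕ) : MaxFun (evensUpTo i) = {2 * i} := by
  have hg : IsGreatest (evensUpTo i) (2 * i) :=
    ⟨⟨i, Set.self_mem_Iic, rfl⟩, by rintro _ ⟨k, hk, rfl⟩; exact Nat.mul_le_mul_left 2 hk⟩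
  have hfin : (evensUpTo i).Finite := (Set.finite_Iic i).image _
  rw [MaxFun, if_neg hg.nonempty.ne_empty, if_neg (Set.not_infinite.2 hfin), hg.csSup_eq]

lemma cardFun_evensUpTo (i : ℕ) : CardFun (evensUpTo i) = {i + 1} := by
  have hfin : (evensUpTo i).Finite := (Set.finite_Iic i).image _
  rw [CardFun, if_pos hfin, evensUpTo,
    Set.ncard_image_of_injective _ fun _ _ h => Nat.eq_of_mul_eq_mul_left two_pos h]
  simp [Set.ncard_eq_toFinset_card']

theorem down_max_card_not_arith_definable :
    ¬ ODef arithO 1 (fun s => DownFun (s 0)) ∧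
    ¬ ODef arithO 1 (fun s => MaxFun (s 0)) ∧
    ¬ ODef arithO 1 (fun s => CardFun (s 0)) := by
  refine ⟨fun h => ?_, fun h => ?_, fun h => ?_⟩ <;>
    obtain ⟨i, j, hij, hagree⟩ := h.finitelyLocal.exists_evensUpTo_agree
  · obtain ⟨_, ⟨k, hk, rfl⟩, hle⟩ :=
      (hagree (2 * i + 1) le_rfl).2 ⟨2 * j, ⟨j, Set.self_mem_Iic, rfl⟩, by omega⟩
    have hki : k ≤ i := hk
    dsimp only at hle
    omega
  · have := hagree (2 * i) (by omega)
    simp only [maxFun_evensUpTo, Set.mem_singleton_iff, true_iff] at this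
    omega
  · have := hagree (i + 1) (by omega)
    simp only [cardFun_evensUpTo, Set.mem_singleton_iff, true_iff] at this
    omega

end
end

section
/- The numerical function n ↦ n ∸ 1 (truncated predecessor: n − 1 if n > 0, and 0 otherwise) is not ({⊕, ⊗} ∪ 𝒫)-definable. -/
noncomputable section
open Classical

/-- `s` and `t` have the same elements up to `m`. -/
def AgreeUpTo (m : ℕ) (s t : Set ℕ) : Prop := ∀ j ≤ m, (j ∈ s ↔ j ∈ t)

theorem AgreeUpTo.setPlus_congr {m : ℕ} {s s' t t' : Set ℕ} (hs : AgreeUpTo m s s')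
    (ht : AgreeUpTo m t t') : AgreeUpTo m (setPlus s t) (setPlus s' t') := by
  rintro j hj
  constructor
  · rintro ⟨a, ha, b, hb, rfl⟩
    exact ⟨a, (hs a (by omega)).1 ha, b, (ht b (by omega)).1 hb, rfl⟩
  · rintro ⟨a, ha, b, hb, rfl⟩
    exact ⟨a, (hs a (by omega)).2 ha, b, (ht b (by omega)).2 hb, rfl⟩

theorem AgreeUpTo.symm {m : ℕ} {s t : Set ℕ} (h : AgreeUpTo m s t) : AgreeUpTo m t s :=
  fun j hj => (h j hj).symm

theorem AgreeUpTo.mem_setTimes {m : ℕ} {s s' t t' : Set ℕ} (hs : AgreeUpTo m s s')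
    (ht : AgreeUpTo m t t') (hs' : s.Nonempty → s'.Nonempty) (ht' : t.Nonempty → t'.Nonempty)
    {j : ℕ} (hj : j ≤ m) (h : j ∈ setTimes s t) : j ∈ setTimes s' t' := by
  obtain ⟨a, ha, b, hb, rfl⟩ := h
  rcases Nat.eq_zero_or_pos a with rfl | hapos
  · obtain ⟨c, hc⟩ := ht' ⟨b, hb⟩
    exact ⟨0, (hs 0 (Nat.zero_le m)).1 ha, c, hc, by simp⟩
  rcases Nat.eq_zero_or_pos b with rfl | hbpos
  · obtain ⟨c, hc⟩ := hs' ⟨a, ha⟩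
    exact ⟨c, hc, 0, (ht 0 (Nat.zero_le m)).1 hb, by simp⟩
  exact ⟨a, (hs a ((Nat.le_mul_of_pos_right a hbpos).trans hj)).1 ha,
    b, (ht b ((Nat.le_mul_of_pos_left b hapos).trans hj)).1 hb, rfl⟩

theorem AgreeUpTo.setTimes_congr {m : ℕ} {s s' t t' : Set ℕ} (hs : AgreeUpTo m s s')
    (ht : AgreeUpTo m t t') (hs' : s.Nonempty ↔ s'.Nonempty) (ht' : t.Nonempty ↔ t'.Nonempty) :
    AgreeUpTo m (setTimes s t) (setTimes s' t') := fun _ hj =>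
  ⟨hs.mem_setTimes ht hs'.1 ht'.1 hj, hs.symm.mem_setTimes ht.symm hs'.2 ht'.2 hj⟩

/-- The domain splits into finitely many pieces, on each of which membership in the value up to
`m` depends only on the elements of the arguments up to `m`. -/
def PiecewiseLocal {n : ℕ} (F : SetFun n) : Prop :=
  ∃ (α : Type) (_ : Finite α) (c : (Fin n → Set ℕ) → α), ∀ s t, c s = c t →
    ∀ m, (∀ i, AgreeUpTo m (s i) (t i)) → AgreeUpTo m (F s) (F t)

theorem PiecewiseLocal.of_local {n : ℕ} {F : SetFun n}
    (h : ∀ s t m, (∀ i, AgreeUpTo m (s i) (t i)) → AgreeUpTo m (F s) (F t)) :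
    PiecewiseLocal F :=
  ⟨Unit, inferInstance, fun _ => (), fun s t _ m => h s t m⟩

theorem PiecewiseLocal.map₂ {n : ℕ} {F G : SetFun n} {op : Set ℕ → Set ℕ → Set ℕ}
    (hF : PiecewiseLocal F) (hG : PiecewiseLocal G)
    (hop : ∀ m s s' t t', AgreeUpTo m s s' → AgreeUpTo m t t' →
      (s.Nonempty ↔ s'.Nonempty) → (t.Nonempty ↔ t'.Nonempty) →
      AgreeUpTo m (op s t) (op s' t')) :
    PiecewiseLocal fun s => op (F s) (G s) := by
  obtain ⟨α, _, c, hc⟩ := hF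
  obtain ⟨β, _, d, hd⟩ := hG
  refine ⟨(α × β) × Prop × Prop, inferInstance,
    fun s => ((c s, d s), (F s).Nonempty, (G s).Nonempty), fun s t hst m h => ?_⟩
  simp only [Prod.mk.injEq] at hst
  obtain ⟨⟨h₁, h₂⟩, h₃, h₄⟩ := hst
  exact hop m _ _ _ _ (hc s t h₁ m h) (hd s t h₂ m h) (iff_of_eq h₃) (iff_of_eq h₄)

theorem PiecewiseLocal.of_predicate {n k : ℕ} {g : SetFun k} (hg : g ∈ Pcal k)
    (F : Fin k → SetFun n) : PiecewiseLocal fun s => g fun i => F i s := by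
  refine ⟨Prop, inferInstance, fun s => (g fun i => F i s) = ∅, fun s t hst m _ => ?_⟩
  have key : (g fun i => F i s) = g fun i => F i t := by
    rcases hg fun i => F i s with h | h <;> rcases hg fun i => F i t with h' | h' <;>
      simp_all
  intro j _
  simp only [key]

theorem mem_arithO {k : ℕ} {g : SetFun k} (hg : g ∈ arithO k) :
    ∃ op : Set ℕ → Set ℕ → Set ℕ, (op = setPlus ∨ op = setTimes) ∧
      ∃ i j : Fin k, g = fun s => op (s i) (s j) := by
  match k, g, hg with
  | 2, g, hg =>
    rcases hg with rfl | rfl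
    · exact ⟨setPlus, .inl rfl, 0, 1, rfl⟩
    · exact ⟨setTimes, .inr rfl, 0, 1, rfl⟩
  | 0, _, hg => exact hg.elim
  | 1, _, hg => exact hg.elim
  | _ + 3, _, hg => exact hg.elim

theorem ODef.piecewiseLocal {n : ℕ} {F : SetFun n} (hF : ODef arithPO n F) :
    PiecewiseLocal F := by
  induction hF with
  | proj i => exact .of_local fun _ _ _ h => h i
  | empty => exact .of_local fun _ _ _ _ _ _ => Iff.rfl
  | univ => exact .of_local fun _ _ _ _ _ _ => Iff.rfl
  | single k => exact .of_local fun _ _ _ _ _ _ => Iff.rfl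
  | union _ _ hF hG =>
    exact hF.map₂ hG fun _ _ _ _ _ hs ht _ _ j hj => or_congr (hs j hj) (ht j hj)
  | inter _ _ hF hG =>
    exact hF.map₂ hG fun _ _ _ _ _ hs ht _ _ j hj => and_congr (hs j hj) (ht j hj)
  | compl _ hF =>
    exact hF.map₂ (op := fun s _ => sᶜ) hF fun _ _ _ _ _ hs _ _ _ j hj => not_congr (hs j hj)
  | @comp k g F hg _ ih =>
    rcases hg with hg | hg
    · obtain ⟨op, rfl | rfl, i, j, rfl⟩ := mem_arithO hg
      · exact (ih i).map₂ (ih j) fun _ _ _ _ _ hs ht _ _ => hs.setPlus_congr ht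
      · exact (ih i).map₂ (ih j) fun _ _ _ _ _ hs ht => hs.setTimes_congr ht
    · exact .of_predicate hg F

theorem truncated_pred_not_arithP_definable :
    ¬ NumDef1 arithPO (fun n => n - 1) := by
  rintro ⟨F, hF, hval⟩
  obtain ⟨α, _, c, hc⟩ := hF.piecewiseLocal
  obtain ⟨a, b, hab, hcol⟩ :=
    Finite.exists_ne_map_eq_of_infinite fun n : ℕ => c fun _ => {n + 1}
  wlog hlt : a < b generalizing a b
  · exact this b a hab.symm hcol.symm (by omega)
  have h := hc _ _ hcol a (fun _ j hj => by
    simp only [Set.mem_singleton_iff]; omega) a le_rfl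
  rw [hval, hval] at h
  simp only [Set.mem_singleton_iff] at h
  omega

end
end
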